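/- Let q : ℝ → [0,∞) be measurable with q(k) ≤ C₀ and q(k) ≤ C₀/k² for all k ≠ 0, for some C₀ > 0. Then for every T > 0 and every γ ∈ [0, 1/4) there is a constant C > 0 such that for all ε ∈ (0,1) and all ν ∈ ℝ with |ν| ≤ 1, sup_{S ∈ [0,T]} ∫_ℝ q(k) |f(S,k)|² (|k|^{2γ} + 1) dk ≤ C (ε² + ε^{1/2}). -/

import Mathlib

open MeasureTheory Set

/-- The error kernel `f(τ,k)`: the Fourier multiplier of the difference between the rescaled
Swift–Hohenberg semigroup and the limiting semigroup of the amplitude equation. -/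
noncomputable def fker (ε ν τ k : ℝ) : ℝ :=
  if -1 / ε ≤ k then
    Real.exp (τ * ν) *
      (Real.exp (-τ * k ^ 2 * (2 + k * ε) ^ 2) - Real.exp (-4 * τ * k ^ 2))
  else
    -(Real.exp (τ * ν) * Real.exp (-4 * τ * k ^ 2))

lemma exp_diff_aux (a b m : ℝ) (ha : m ≤ a) (hb : m ≤ b) :
    |Real.exp (-a) - Real.exp (-b)| ≤ |a - b| * Real.exp (-m) := by
  have key : ∀ x y : ℝ, m ≤ x → x ≤ y →
      |Real.exp (-x) - Real.exp (-y)| ≤ |x - y| * Real.exp (-m) := by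
    intro x y hx hxy
    have h1 : Real.exp (-y) ≤ Real.exp (-x) := Real.exp_le_exp.2 (by linarith)
    rw [abs_of_nonneg (by linarith), abs_of_nonpos (by linarith)]
    have h2 : Real.exp (-y) = Real.exp (-x) * Real.exp (x - y) := by
      rw [← Real.exp_add]; ring_nf
    have h3 := Real.add_one_le_exp (x - y)
    have h4 : Real.exp (-x) ≤ Real.exp (-m) := Real.exp_le_exp.2 (by linarith)
    have h5 := Real.exp_pos (-x)
    rw [h2]
    nlinarith [mul_le_mul_of_nonneg_left h3 h5.le, mul_le_mul_of_nonneg_left h4 (sub_nonneg.2 hxy)]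
  rcases le_total a b with h | h
  · exact key a b ha h
  · rw [abs_sub_comm, abs_sub_comm a b]; exact key b a hb h

lemma fker_abs_le (T ε ν τ k : ℝ) (hν : |ν| ≤ 1) (h0 : 0 ≤ τ) (hT : τ ≤ T) :
    |fker ε ν τ k| ≤ Real.exp T := by
  have hE : Real.exp (τ * ν) ≤ Real.exp T :=
    Real.exp_le_exp.2 (by nlinarith [(abs_le.1 hν).2])
  have hp := Real.exp_pos (τ * ν)
  have h1 : Real.exp (-4 * τ * k ^ 2) ≤ 1 :=
    Real.exp_le_one_iff.2 (by nlinarith [mul_nonneg h0 (sq_nonneg k)])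
  have h1' := Real.exp_pos (-4 * τ * k ^ 2)
  unfold fker
  split_ifs with h
  · have h2 : Real.exp (-τ * k ^ 2 * (2 + k * ε) ^ 2) ≤ 1 :=
      Real.exp_le_one_iff.2 (by
        nlinarith [mul_nonneg (mul_nonneg h0 (sq_nonneg k)) (sq_nonneg (2 + k * ε))])
    have h2' := Real.exp_pos (-τ * k ^ 2 * (2 + k * ε) ^ 2)
    rw [abs_mul, abs_of_pos hp]
    calc _ ≤ Real.exp (τ * ν) * 1 := by
          gcongr
          rw [abs_le]; constructor <;> linarith
      _ ≤ _ := by linarith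
  · rw [abs_neg, abs_mul, abs_of_pos hp, abs_of_pos h1']
    nlinarith

lemma fker_abs_le' (T ε ν τ k : ℝ) (hε : 0 < ε) (hν : |ν| ≤ 1) (h0 : 0 ≤ τ) (hT : τ ≤ T) :
    |fker ε ν τ k| ≤ 5 * Real.exp T * (ε * |k|) := by
  have hET := Real.exp_pos T
  rcases le_total 1 (ε * |k|) with hk | hk
  · have := fker_abs_le T ε ν τ k hν h0 hT
    nlinarith
  have hk' : |k * ε| ≤ 1 := by rw [abs_mul, abs_of_pos hε]; linarith
  have hk2 := abs_le.1 hk'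
  have hcond : -1 / ε ≤ k := by rw [div_le_iff₀ hε]; linarith
  have hE : Real.exp (τ * ν) ≤ Real.exp T :=
    Real.exp_le_exp.2 (by nlinarith [(abs_le.1 hν).2])
  have hp := Real.exp_pos (τ * ν)
  unfold fker
  rw [if_pos hcond, abs_mul, abs_of_pos hp]
  set m := τ * k ^ 2 with hm
  have hm0 : 0 ≤ m := by positivity
  have e := exp_diff_aux (m * (2 + k * ε) ^ 2) (4 * m) m
    (by nlinarith [mul_nonneg hm0 (show (0:ℝ) ≤ (2 + k * ε) ^ 2 - 1 by nlinarith)]) (by linarith)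
  have e1 : -τ * k ^ 2 * (2 + k * ε) ^ 2 = -(m * (2 + k * ε) ^ 2) := by rw [hm]; ring
  have e2 : -4 * τ * k ^ 2 = -(4 * m) := by rw [hm]; ring
  rw [e1, e2]
  have e3 : |m * (2 + k * ε) ^ 2 - 4 * m| ≤ m * (5 * (ε * |k|)) := by
    have : m * (2 + k * ε) ^ 2 - 4 * m = m * ((4 + k * ε) * (ε * k)) := by ring
    rw [this, abs_mul, abs_of_nonneg hm0, abs_mul, abs_mul, abs_of_pos hε]
    gcongr
    rw [abs_le]; constructor <;> linarith
  have e4 : m * Real.exp (-m) ≤ 1 := by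
    have := Real.add_one_le_exp m
    rw [Real.exp_neg, ← div_eq_mul_inv, div_le_one (Real.exp_pos m)]; linarith
  have e5 : |Real.exp (-(m * (2 + k * ε) ^ 2)) - Real.exp (-(4 * m))| ≤ 5 * (ε * |k|) := by
    calc _ ≤ _ := e
      _ ≤ m * (5 * (ε * |k|)) * Real.exp (-m) := by gcongr
      _ = (m * Real.exp (-m)) * (5 * (ε * |k|)) := by ring
      _ ≤ 1 * (5 * (ε * |k|)) := by gcongr
      _ = _ := one_mul _
  calc _ ≤ Real.exp T * (5 * (ε * |k|)) := by gcongr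
    _ = _ := by ring

lemma min_aux (x : ℝ) (hx : 0 < x) :
    x ^ (-(3/2) : ℝ) * min 1 (x ^ 2) ≤ 2 * (1 + x ^ 2) ^ (-(3/4) : ℝ) := by
  have h2 : (2:ℝ)⁻¹ ≤ 2 ^ (-(3/4) : ℝ) := by
    rw [← Real.rpow_neg_one]
    exact Real.rpow_le_rpow_of_exponent_le (by norm_num) (by norm_num)
  rcases le_total x 1 with h | h
  · have a1 : x ^ (-(3/2) : ℝ) * min 1 (x ^ 2) ≤ 1 := by
      calc _ ≤ x ^ (-(3/2) : ℝ) * x ^ 2 := by gcongr; exact min_le_right _ _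
        _ = x ^ (1/2 : ℝ) := by
          rw [← Real.rpow_natCast x 2, ← Real.rpow_add hx]; norm_num
        _ ≤ 1 := Real.rpow_le_one hx.le h (by norm_num)
    have a2 : (2:ℝ) ^ (-(3/4) : ℝ) ≤ (1 + x ^ 2) ^ (-(3/4) : ℝ) :=
      Real.rpow_le_rpow_of_nonpos (by positivity) (by nlinarith) (by norm_num)
    linarith
  · have a2 : (2 * x ^ 2) ^ (-(3/4) : ℝ) ≤ (1 + x ^ 2) ^ (-(3/4) : ℝ) :=
      Real.rpow_le_rpow_of_nonpos (by positivity) (by nlinarith) (by norm_num)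
    have a3 : (2 * x ^ 2) ^ (-(3/4) : ℝ) = 2 ^ (-(3/4) : ℝ) * x ^ (-(3/2) : ℝ) := by
      rw [Real.mul_rpow (by norm_num) (by positivity), ← Real.rpow_natCast x 2,
        ← Real.rpow_mul hx.le]; norm_num
    have hp : 0 < x ^ (-(3/2) : ℝ) := by positivity
    calc _ ≤ x ^ (-(3/2) : ℝ) * 1 := by gcongr; exact min_le_left _ _
      _ ≤ _ := by nlinarith

lemma pt_bound (q C₀ T γ ε ν τ k : ℝ) (hC₀ : 0 < C₀) (hq0 : 0 ≤ q) (hqb : q ≤ C₀)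
    (hqd : k ≠ 0 → q ≤ C₀ / k ^ 2) (hγ0 : 0 ≤ γ) (hγ : γ < 1 / 4)
    (hε : 0 < ε) (hν : |ν| ≤ 1) (h0 : 0 ≤ τ) (hT : τ ≤ T) :
    q * fker ε ν τ k ^ 2 * (|k| ^ (2 * γ) + 1) ≤
      100 * C₀ * Real.exp T ^ 2 *
        (ε ^ 2 * (1 + k ^ 2)⁻¹ + ε ^ (3/2 : ℝ) * (1 + (ε * k) ^ 2) ^ (-(3/4) : ℝ)) := by
  have f1 := fker_abs_le T ε ν τ k hν h0 hT
  have f2 := fker_abs_le' T ε ν τ k hε hν h0 hT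
  have hET := Real.exp_pos T
  have g1 : fker ε ν τ k ^ 2 ≤ 25 * Real.exp T ^ 2 * 1 := by
    rw [← sq_abs]
    nlinarith [pow_le_pow_left₀ (abs_nonneg _) f1 2]
  have g2 : fker ε ν τ k ^ 2 ≤ 25 * Real.exp T ^ 2 * (ε * |k|) ^ 2 := by
    rw [← sq_abs]
    nlinarith [pow_le_pow_left₀ (abs_nonneg _) f2 2]
  set A : ℝ := ε ^ 2 * (1 + k ^ 2)⁻¹ with hA
  set B : ℝ := ε ^ (3/2 : ℝ) * (1 + (ε * k) ^ 2) ^ (-(3/4) : ℝ) with hB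
  have hA0 : 0 ≤ A := by positivity
  have hB0 : 0 ≤ B := by positivity
  have hK : 0 ≤ 100 * C₀ * Real.exp T ^ 2 := by positivity
  rcases le_total |k| 1 with h | h
  · have w : |k| ^ (2 * γ) + 1 ≤ 2 := by
      have := Real.rpow_le_one (abs_nonneg k) h (show 0 ≤ 2 * γ by linarith)
      linarith
    have hk2 : k ^ 2 ≤ 1 := by rw [← sq_abs]; nlinarith [abs_nonneg k]
    have hA2 : ε ^ 2 ≤ 2 * A := by
      have : (2:ℝ)⁻¹ ≤ (1 + k ^ 2)⁻¹ := by gcongr; linarith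
      rw [hA]; nlinarith [sq_nonneg ε]
    have g3 : fker ε ν τ k ^ 2 ≤ 25 * Real.exp T ^ 2 * ε ^ 2 := by
      refine g2.trans ?_
      gcongr
      nlinarith
    calc _ ≤ C₀ * (25 * Real.exp T ^ 2 * ε ^ 2) * 2 := by gcongr
      _ = 50 * C₀ * Real.exp T ^ 2 * ε ^ 2 := by ring
      _ ≤ 50 * C₀ * Real.exp T ^ 2 * (2 * A) := by gcongr
      _ = 100 * C₀ * Real.exp T ^ 2 * A := by ring
      _ ≤ _ := by gcongr; linarith
  · have hkp : 0 < |k| := by linarith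
    have w : |k| ^ (2 * γ) + 1 ≤ 2 * |k| ^ (1/2 : ℝ) := by
      have a := Real.rpow_le_rpow_of_exponent_le h (show 2 * γ ≤ 1/2 by linarith)
      have b := Real.one_le_rpow h (show (0:ℝ) ≤ 1/2 by norm_num)
      linarith
    have g3 : fker ε ν τ k ^ 2 ≤ 25 * Real.exp T ^ 2 * min 1 ((ε * |k|) ^ 2) := by
      rw [mul_min_of_nonneg _ _ (by positivity)]
      exact le_min g1 g2
    have hx := min_aux (ε * |k|) (by positivity)
    have hq := hqd (abs_pos.1 hkp)
    have e1 : (|k| ^ 2)⁻¹ * |k| ^ (1/2 : ℝ) = ε ^ (3/2 : ℝ) * (ε * |k|) ^ (-(3/2) : ℝ) := by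
      rw [Real.mul_rpow hε.le hkp.le, ← mul_assoc, ← Real.rpow_add hε, ← Real.rpow_natCast |k| 2,
        ← Real.rpow_neg hkp.le, ← Real.rpow_add hkp]
      norm_num
    have e2 : (ε * |k|) ^ 2 = (ε * k) ^ 2 := by rw [mul_pow, mul_pow, sq_abs]
    calc _ ≤ C₀ / k ^ 2 * (25 * Real.exp T ^ 2 * min 1 ((ε * |k|) ^ 2)) * (2 * |k| ^ (1/2 : ℝ)) := by
            gcongr
      _ = 50 * C₀ * Real.exp T ^ 2 * (((|k| ^ 2)⁻¹ * |k| ^ (1/2 : ℝ)) * min 1 ((ε * |k|) ^ 2)) := by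
            rw [sq_abs]; ring
      _ = 50 * C₀ * Real.exp T ^ 2 * (ε ^ (3/2 : ℝ) *
            ((ε * |k|) ^ (-(3/2) : ℝ) * min 1 ((ε * |k|) ^ 2))) := by rw [e1]; ring
      _ ≤ 50 * C₀ * Real.exp T ^ 2 * (ε ^ (3/2 : ℝ) *
            (2 * (1 + (ε * |k|) ^ 2) ^ (-(3/4) : ℝ))) := by gcongr
      _ = 100 * C₀ * Real.exp T ^ 2 * B := by rw [e2, hB]; ring
      _ ≤ _ := by gcongr; linarith

/-- Gaussian estimate, first supremum: if the covariance symbol `q` satisfies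
`0 ≤ q(k) ≤ C₀` and `q(k) ≤ C₀/k²` for `k ≠ 0`, then for `T > 0` and `γ ∈ [0,1/4)` there is
`C > 0` such that for all `ε ∈ (0,1)` and `|ν| ≤ 1`,
`sup_{S∈[0,T]} ∫_ℝ q(k) |f(S,k)|² (|k|^{2γ}+1) dk ≤ C (ε² + ε^{1/2})`. -/
theorem stmt_16 (q : ℝ → ℝ) (C₀ : ℝ) (hC₀ : 0 < C₀) (hqm : Measurable q)
    (hq0 : ∀ k, 0 ≤ q k) (hqb : ∀ k, q k ≤ C₀) (hqd : ∀ k : ℝ, k ≠ 0 → q k ≤ C₀ / k ^ 2)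
    (T : ℝ) (hT : 0 < T) (γ : ℝ) (hγ : γ ∈ Set.Ico (0 : ℝ) (1 / 4)) :
    ∃ C > (0 : ℝ), ∀ ε ∈ Set.Ioo (0 : ℝ) 1, ∀ ν : ℝ, |ν| ≤ 1 →
      (⨆ (S : ℝ) (_ : S ∈ Set.Icc (0 : ℝ) T),
          ∫⁻ k : ℝ, ENNReal.ofReal (q k * fker ε ν S k ^ 2 * (|k| ^ (2 * γ) + 1))) ≤
        ENNReal.ofReal (C * (ε ^ 2 + ε ^ ((1 : ℝ) / 2))) := by
  have hJ : Integrable (fun x : ℝ => (1 + x ^ 2) ^ (-(3/4) : ℝ)) := by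
    have := integrable_rpow_neg_one_add_norm_sq (E := ℝ) (μ := volume) (r := 3/2)
      (by norm_num)
    refine this.congr (Filter.Eventually.of_forall fun x => ?_)
    simp only [Real.norm_eq_abs, sq_abs]
    norm_num
  set J := ∫ x : ℝ, (1 + x ^ 2) ^ (-(3/4) : ℝ) with hJd
  have hJ0 : 0 ≤ J := integral_nonneg fun x => by positivity
  have hpi := Real.pi_pos
  refine ⟨100 * C₀ * Real.exp T ^ 2 * (Real.pi + J), by positivity, ?_⟩
  intro ε hε ν hν
  have hε0 : 0 < ε := hε.1
  refine iSup₂_le fun S hS => ?_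
  have i1 : Integrable (fun k : ℝ => ε ^ 2 * (1 + k ^ 2)⁻¹) := integrable_inv_one_add_sq.const_mul _
  have i2 : Integrable (fun k : ℝ => ε ^ (3/2 : ℝ) * (1 + (ε * k) ^ 2) ^ (-(3/4) : ℝ)) :=
    (hJ.comp_mul_left' hε0.ne').const_mul _
  have i3 := (i1.add i2).const_mul (100 * C₀ * Real.exp T ^ 2)
  have hsc : ∫ k : ℝ, (1 + (ε * k) ^ 2) ^ (-(3/4) : ℝ) = ε⁻¹ * J := by
    have := Measure.integral_comp_mul_left (fun x : ℝ => (1 + x ^ 2) ^ (-(3/4) : ℝ)) ε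
    rw [this, abs_of_pos (by positivity), smul_eq_mul]
  have e1 : ε ^ (3/2 : ℝ) * ε⁻¹ = ε ^ (1/2 : ℝ) := by
    rw [← Real.rpow_neg_one ε, ← Real.rpow_add hε0]; norm_num
  have hval : ∫ k : ℝ, 100 * C₀ * Real.exp T ^ 2 *
        (ε ^ 2 * (1 + k ^ 2)⁻¹ + ε ^ (3/2 : ℝ) * (1 + (ε * k) ^ 2) ^ (-(3/4) : ℝ)) =
      100 * C₀ * Real.exp T ^ 2 * (ε ^ 2 * Real.pi + ε ^ (1/2 : ℝ) * J) := by
    rw [integral_const_mul, integral_add i1 i2, integral_const_mul, integral_const_mul,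
      integral_univ_inv_one_add_sq, hsc, ← mul_assoc (ε ^ (3/2 : ℝ)), e1]
  calc _ ≤ ∫⁻ k : ℝ, ENNReal.ofReal (100 * C₀ * Real.exp T ^ 2 *
        (ε ^ 2 * (1 + k ^ 2)⁻¹ + ε ^ (3/2 : ℝ) * (1 + (ε * k) ^ 2) ^ (-(3/4) : ℝ))) :=
        lintegral_mono fun k => ENNReal.ofReal_le_ofReal
          (pt_bound (q k) C₀ T γ ε ν S k hC₀ (hq0 k) (hqb k) (hqd k) hγ.1 hγ.2 hε0 hν hS.1 hS.2)
    _ = ENNReal.ofReal (∫ k : ℝ, 100 * C₀ * Real.exp T ^ 2 *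
        (ε ^ 2 * (1 + k ^ 2)⁻¹ + ε ^ (3/2 : ℝ) * (1 + (ε * k) ^ 2) ^ (-(3/4) : ℝ))) :=
        (ofReal_integral_eq_lintegral_ofReal i3
          (Filter.Eventually.of_forall fun k => by
            have : 0 ≤ 100 * C₀ * Real.exp T ^ 2 * (ε ^ 2 * (1 + k ^ 2)⁻¹ +
              ε ^ (3/2 : ℝ) * (1 + (ε * k) ^ 2) ^ (-(3/4) : ℝ)) := by positivity
            exact this)).symm
    _ ≤ _ := by
        rw [hval]
        apply ENNReal.ofReal_le_ofReal
        rw [mul_assoc (100 * C₀ * Real.exp T ^ 2)]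
        gcongr
        have : 0 ≤ ε ^ (1/2 : ℝ) := by positivity
        nlinarith [mul_nonneg (sq_nonneg ε) hJ0, mul_nonneg this hpi.le]
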